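/- Auxiliary determinant evaluation: for pairwise distinct complex u₁,...,uₙ and v₁,...,vₙ, and t = ∑ₗ(uₗ-vₗ)+γ, the n×n matrix X with entries X_{jk} = ([0]'/[t]) · (∏ₗ [u_k - v_l] / ∏_{l≠k} [u_k - u_l]) · [v_j - u_k + t]/[v_j - u_k] has determinant det X = (-[0]')ⁿ · ([γ]/[t]) · ∏_{j<k} [v_j - v_k]/[u_j - u_k], where [u] = θ₁(ηu;τ) and [0]' = d/du [u] at u=0. -/

import Mathlib

open Complex Real BigOperators

/-- The Jacobi theta function `θ₁(z;τ)`. -/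
noncomputable def jacobiTheta₁ (z τ : ℂ) : ℂ :=
  -Complex.I * ∑' k : ℤ, (-1 : ℂ) ^ k *
    Complex.exp ((π : ℂ) * Complex.I * τ * ((k : ℂ) + 1 / 2) ^ 2) *
    Complex.exp (2 * (π : ℂ) * Complex.I * ((k : ℂ) + 1 / 2) * z)

/-- The derivative of `θ₁` with respect to `z`. -/
noncomputable def jacobiTheta₁' (z τ : ℂ) : ℂ :=
  deriv (fun w => jacobiTheta₁ w τ) z

lemma jacobiTheta₁_summand_eq (k : ℤ) (z τ : ℂ) :
    (-1 : ℂ) ^ k * cexp (π * I * τ * ((k : ℂ) + 1 / 2) ^ 2) *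
        cexp (2 * π * I * ((k : ℂ) + 1 / 2) * z) =
      cexp (π * I * τ / 4 + π * I * z) * jacobiTheta₂_term k (z + τ / 2 + 1 / 2) τ := by
  rw [← Complex.exp_pi_mul_I, ← Complex.exp_int_mul, jacobiTheta₂_term, ← Complex.exp_add,
    ← Complex.exp_add, ← Complex.exp_add]
  congr 1
  ring

lemma jacobiTheta₁_eq (z τ : ℂ) :
    jacobiTheta₁ z τ =
      -I * (cexp (π * I * τ / 4 + π * I * z) * jacobiTheta₂ (z + τ / 2 + 1 / 2) τ) := by
  simp only [jacobiTheta₁, jacobiTheta₁_summand_eq, tsum_mul_left, jacobiTheta₂]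

lemma differentiable_jacobiTheta₁ {τ : ℂ} (hτ : 0 < τ.im) :
    Differentiable ℂ (fun z => jacobiTheta₁ z τ) := by
  have h : Differentiable ℂ (fun z => jacobiTheta₂ z τ) :=
    fun z => differentiableAt_jacobiTheta₂_fst z hτ
  have h' : Differentiable ℂ (fun z => jacobiTheta₂ (z + τ / 2 + 1 / 2) τ) :=
    h.comp (f := fun z : ℂ => z + τ / 2 + 1 / 2) (by fun_prop)
  simp only [jacobiTheta₁_eq]
  fun_prop

lemma HasSum.int_prod_of_parity {α : Type*} [AddCommMonoid α] [TopologicalSpace α]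
    [ContinuousAdd α] {f : ℤ × ℤ → α} {a b : α}
    (h₀ : HasSum (fun p : ℤ × ℤ => f (p.1 + p.2, p.1 - p.2)) a)
    (h₁ : HasSum (fun p : ℤ × ℤ => f (p.1 + p.2, p.1 - p.2 - 1)) b) :
    HasSum f (a + b) := by
  have i₀ : Function.Injective fun p : ℤ × ℤ => (p.1 + p.2, p.1 - p.2) := by
    rintro ⟨a, b⟩ ⟨c, d⟩ h
    simp only [Prod.mk.injEq] at h ⊢
    lia
  have i₁ : Function.Injective fun p : ℤ × ℤ => (p.1 + p.2, p.1 - p.2 - 1) := by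
    rintro ⟨a, b⟩ ⟨c, d⟩ h
    simp only [Prod.mk.injEq] at h ⊢
    lia
  refine HasSum.add_isCompl ⟨?_, ?_⟩ (i₀.hasSum_range_iff.mpr h₀) (i₁.hasSum_range_iff.mpr h₁)
  · rw [Set.disjoint_left]
    rintro _ ⟨⟨a, b⟩, rfl⟩ ⟨⟨c, d⟩, h⟩
    simp only [Prod.mk.injEq] at h
    lia
  · rw [codisjoint_iff_le_sup]
    rintro ⟨k, l⟩ -
    rcases Int.even_or_odd' (k + l) with ⟨m, hm | hm⟩
    · exact Or.inl ⟨(m, k - m), by simp only [Prod.mk.injEq]; lia⟩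
    · exact Or.inr ⟨(m + 1, k - m - 1), by simp only [Prod.mk.injEq]; lia⟩

lemma HasSum.mul_complex {ι κ : Type*} {f : ι → ℂ} {g : κ → ℂ} {a b : ℂ}
    (hf : HasSum f a) (hg : HasSum g b) :
    HasSum (fun p : ι × κ => f p.1 * g p.2) (a * b) := by
  have hf' : Summable fun i => ‖f i‖ := hf.summable.norm
  have hg' : Summable fun i => ‖g i‖ := hg.summable.norm
  rw [← hf.tsum_eq, ← hg.tsum_eq, tsum_mul_tsum_of_summable_norm hf' hg']
  exact (summable_mul_of_summable_norm hf' hg').hasSum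

lemma hasSum_const_mul_jacobiTheta₂_term (c z : ℂ) {τ : ℂ} (hτ : 0 < τ.im) :
    HasSum (fun k : ℤ => c * jacobiTheta₂_term k z τ) (c * jacobiTheta₂ z τ) :=
  (hasSum_jacobiTheta₂_term z hτ).mul_left c

lemma hasSum_mul_jacobiTheta₂_term (c d z w : ℂ) {τ : ℂ} (hτ : 0 < τ.im) :
    HasSum (fun p : ℤ × ℤ => (c * jacobiTheta₂_term p.1 z τ) * (d * jacobiTheta₂_term p.2 w τ))
      ((c * jacobiTheta₂ z τ) * (d * jacobiTheta₂ w τ)) :=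
  ((hasSum_const_mul_jacobiTheta₂_term c z hτ).mul_complex
    (hasSum_const_mul_jacobiTheta₂_term d w hτ)).congr_fun fun _ => rfl

lemma jacobiTheta₁_add_mul_sub {τ : ℂ} (hτ : 0 < τ.im) (x y : ℂ) :
    jacobiTheta₁ (x + y) τ * jacobiTheta₁ (x - y) τ =
      jacobiTheta₂ (2 * x) (2 * τ) *
          (cexp (π * I * τ / 2 + 2 * π * I * y) * jacobiTheta₂ (2 * y + τ) (2 * τ)) -
        (cexp (π * I * τ / 2 + 2 * π * I * x) * jacobiTheta₂ (2 * x + τ) (2 * τ)) *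
          jacobiTheta₂ (2 * y) (2 * τ) := by
  have hτ2 : 0 < (2 * τ).im := by simpa using hτ
  have h := hasSum_mul_jacobiTheta₂_term (cexp (π * I * τ / 4 + π * I * (x + y)))
    (cexp (π * I * τ / 4 + π * I * (x - y))) (x + y + τ / 2 + 1 / 2) (x - y + τ / 2 + 1 / 2) hτ
  have h₀ := hasSum_mul_jacobiTheta₂_term (cexp (π * I * τ / 2 + 2 * π * I * x)) 1
    (2 * x + τ) (2 * y) hτ2
  have h₁ := (hasSum_mul_jacobiTheta₂_term 1 (cexp (π * I * τ / 2 + 2 * π * I * y))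
    (2 * x) (2 * y + τ) hτ2).neg
  have key := h.unique (HasSum.int_prod_of_parity (h₀.congr_fun ?_) (h₁.congr_fun ?_))
  · rw [jacobiTheta₁_eq, jacobiTheta₁_eq]
    linear_combination (-1 : ℂ) * key + I_sq *
      (cexp (π * I * τ / 4 + π * I * (x + y)) * jacobiTheta₂ (x + y + τ / 2 + 1 / 2) τ *
        (cexp (π * I * τ / 4 + π * I * (x - y)) * jacobiTheta₂ (x - y + τ / 2 + 1 / 2) τ))
  · rintro ⟨a, b⟩
    simp only [jacobiTheta₂_term, one_mul, ← Complex.exp_add]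
    rw [Complex.exp_eq_exp_iff_exists_int]
    refine ⟨a, ?_⟩
    push_cast
    ring
  · rintro ⟨a, b⟩
    simp only [jacobiTheta₂_term, one_mul, ← Complex.exp_add]
    rw [← neg_one_mul, ← Complex.exp_pi_mul_I, ← Complex.exp_add, Complex.exp_eq_exp_iff_exists_int]
    refine ⟨a - 1, ?_⟩
    push_cast
    ring

section ThetaLike

variable {f φ ψ : ℂ → ℂ}

lemma odd_of_add_mul_sub (hf : ∀ x y, f (x + y) * f (x - y) = φ x * ψ y - ψ x * φ y) {w : ℂ}
    (hw : f w ≠ 0) (z : ℂ) : f (-z) = -f z := by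
  have h₁ := hf ((w + z) / 2) ((w - z) / 2)
  have h₂ := hf ((w - z) / 2) ((w + z) / 2)
  rw [show (w + z) / 2 + (w - z) / 2 = w by ring,
    show (w + z) / 2 - (w - z) / 2 = z by ring] at h₁
  rw [show (w - z) / 2 + (w + z) / 2 = w by ring,
    show (w - z) / 2 - (w + z) / 2 = -z by ring] at h₂
  exact mul_left_cancel₀ hw (by linear_combination h₁ + h₂)

/-- The three-term (Fay) identity, in the form needed for Gaussian elimination in the elliptic
Cauchy matrix. -/
lemma three_term_of_add_mul_sub
    (hf : ∀ x y, f (x + y) * f (x - y) = φ x * ψ y - ψ x * φ y) (x p y q t : ℂ) :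
    f (x - y + t) * f (p - q + t) * (f (x - q) * f (p - y)) -
        f (x - q + t) * f (p - y + t) * (f (x - y) * f (p - q)) =
      f (x - y + (t + (p - q))) * f t * (f (x - p) * f (q - y)) := by
  have hf' (a b c d : ℂ) (h : a + c = 2 * b) (h' : a - c = 2 * d) :
      f a * f c = φ b * ψ d - ψ b * φ d := by
    rw [← hf, show a = b + d by linear_combination (h + h') / 2,
      show c = b - d by linear_combination (h - h') / 2]
  set a := (x + p - y - q) / 2 + t with ha
  set b := (x + p - y - q) / 2 with hb
  set c := (x - p + q - y) / 2 with hc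
  set d := (x - p - q + y) / 2 with hd
  rw [hf' (x - y + t) a (p - q + t) c (by ring) (by ring),
    hf' (x - q) b (p - y) d (by ring) (by ring),
    hf' (x - q + t) a (p - y + t) d (by ring) (by ring),
    hf' (x - y) b (p - q) c (by ring) (by ring),
    hf' (x - y + (t + (p - q))) a t b (by ring) (by ring),
    hf' (x - p) c (q - y) d (by ring) (by ring)]
  ring

lemma Matrix.det_eq_mul_det_schur {n : ℕ} {K : Type*} [Field K]
    (M : Matrix (Fin (n + 1)) (Fin (n + 1)) K) (h : M 0 0 ≠ 0) :
    M.det = M 0 0 *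
      (Matrix.of fun i j : Fin n => M i.succ j.succ - M i.succ 0 / M 0 0 * M 0 j.succ).det := by
  let N : Matrix (Fin (n + 1)) (Fin (n + 1)) K :=
    Matrix.of fun i j => M i j - (if i = 0 then 0 else M i 0 / M 0 0) * M 0 j
  have hMN : M.det = N.det := by
    refine Matrix.det_eq_of_forall_row_eq_smul_add_const
      (fun i => if i = 0 then 0 else M i 0 / M 0 0) 0 (by simp) fun i j => ?_
    simp [N]
  rw [hMN, Matrix.det_succ_column_zero, Fin.sum_univ_succ, Finset.sum_eq_zero]
  · simp only [Fin.val_zero, pow_zero, one_mul, add_zero]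
    congr 1
    simp [N]
  · intro i _
    simp [N, h]

lemma det_ellipticCauchy_succ {n : ℕ}
    (hf : ∀ x y, f (x + y) * f (x - y) = φ x * ψ y - ψ x * φ y) {x y : Fin (n + 1) → ℂ}
    (hxy : ∀ j k, f (x j - y k) ≠ 0) {t : ℂ} (ht : f (t + (x 0 - y 0)) ≠ 0) :
    (Matrix.of fun j k => f (x j - y k + t) / f (x j - y k)).det =
      f (t + (x 0 - y 0)) / f (x 0 - y 0) *
        ((∏ j : Fin n, f t / f (t + (x 0 - y 0)) *
            (f (x j.succ - x 0) / f (x j.succ - y 0))) *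
          ((∏ k : Fin n, f (y 0 - y k.succ) / f (x 0 - y k.succ)) *
            (Matrix.of fun j k : Fin n =>
              f (x j.succ - y k.succ + (t + (x 0 - y 0))) / f (x j.succ - y k.succ)).det)) := by
  have ht' : f (x 0 - y 0 + t) ≠ 0 := by rwa [add_comm]
  rw [Matrix.det_eq_mul_det_schur _ (by simpa using ⟨ht', hxy 0 0⟩),
    ← Matrix.det_mul_row, ← Matrix.det_mul_column]
  congr 1
  · simp [add_comm]
  · congr 1
    ext j k
    have h := three_term_of_add_mul_sub hf (x j.succ) (x 0) (y k.succ) (y 0) t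
    have := hxy 0 0
    have := hxy j.succ 0
    have := hxy 0 k.succ
    have := hxy j.succ k.succ
    rw [add_comm t] at ht ⊢
    rw [add_comm t] at h
    simp only [Matrix.of_apply]
    field_simp
    linear_combination h

/-- Frobenius' determinant formula for the elliptic Cauchy matrix. -/
theorem det_ellipticCauchy (hd : Differentiable ℂ f)
    (hf : ∀ x y, f (x + y) * f (x - y) = φ x * ψ y - ψ x * φ y) {w : ℂ} (hw : f w ≠ 0)
    {n : ℕ} {x y : Fin n → ℂ} (hxy : ∀ j k, f (x j - y k) ≠ 0) (t : ℂ) :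
    f t * (Matrix.of fun j k => f (x j - y k + t) / f (x j - y k)).det =
      f t ^ n * f (t + ∑ j, (x j - y j)) *
        (∏ j, ∏ k ∈ Finset.Ioi j, f (x j - x k) * f (y k - y j)) /
        ∏ j, ∏ k, f (x j - y k) := by
  induction n generalizing t with
  | zero => simp
  | succ n ih =>
    have hodd := odd_of_add_mul_sub hf hw
    have generic (t : ℂ) (ht : f (t + (x 0 - y 0)) ≠ 0) :
        f t * (Matrix.of fun j k => f (x j - y k + t) / f (x j - y k)).det =
          f t ^ (n + 1) * f (t + ∑ j, (x j - y j)) *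
            (∏ j, ∏ k ∈ Finset.Ioi j, f (x j - x k) * f (y k - y j)) /
            ∏ j, ∏ k, f (x j - y k) := by
      have IH := ih (x := fun j => x j.succ) (y := fun j => y j.succ)
        (fun j k => hxy j.succ k.succ) (t + (x 0 - y 0))
      have hsign : (∏ k : Fin n, f (x 0 - x k.succ)) * ∏ k : Fin n, f (y k.succ - y 0) =
          (∏ k : Fin n, f (x k.succ - x 0)) * ∏ k : Fin n, f (y 0 - y k.succ) := by
        rw [← Finset.prod_mul_distrib, ← Finset.prod_mul_distrib]
        refine Finset.prod_congr rfl fun k _ => ?_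
        rw [← neg_sub, hodd, ← neg_sub (y 0), hodd]
        ring
      rw [det_ellipticCauchy_succ hf hxy ht]
      simp only [Fin.prod_univ_succ (n := n), Fin.sum_univ_succ (n := n), Fin.prod_Ioi_zero,
        Fin.prod_Ioi_succ, Finset.prod_mul_distrib, Finset.prod_div_distrib,
        Finset.prod_const, Finset.card_univ, Fintype.card_fin] at IH ⊢
      have h₀ := hxy 0 0
      have h₁ : ∏ k : Fin n, f (x 0 - y k.succ) ≠ 0 := Finset.prod_ne_zero_iff.mpr
        fun k _ => hxy 0 k.succ
      have h₂ : ∏ k : Fin n, f (x k.succ - y 0) ≠ 0 := Finset.prod_ne_zero_iff.mpr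
        fun k _ => hxy k.succ 0
      have h₃ : ∏ j : Fin n, ∏ k : Fin n, f (x j.succ - y k.succ) ≠ 0 :=
        Finset.prod_ne_zero_iff.mpr fun j _ => Finset.prod_ne_zero_iff.mpr
          fun k _ => hxy j.succ k.succ
      rw [add_assoc] at IH
      rw [eq_div_iff h₃] at IH
      field_simp
      linear_combination f t * f t ^ n * (∏ k : Fin n, f (x k.succ - x 0)) *
        (∏ k : Fin n, f (y 0 - y k.succ)) * IH -
        f t * f t ^ n * f (t + (x 0 - y 0)) ^ n *
        f (t + (x 0 - y 0 + ∑ j : Fin n, (x j.succ - y j.succ))) *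
        (∏ j : Fin n, ∏ k ∈ Finset.Ioi j, f (x j.succ - x k.succ)) *
        (∏ j : Fin n, ∏ k ∈ Finset.Ioi j, f (y k.succ - y j.succ)) * hsign
    have hzero := AnalyticOnNhd.eq_zero_or_eq_zero_of_mul_eq_zero (U := Set.univ)
      (f := fun t => f (t + (x 0 - y 0)))
      (g := fun t => f t * (Matrix.of fun j k => f (x j - y k + t) / f (x j - y k)).det -
        f t ^ (n + 1) * f (t + ∑ j, (x j - y j)) *
          (∏ j, ∏ k ∈ Finset.Ioi j, f (x j - x k) * f (y k - y j)) /
          ∏ j, ∏ k, f (x j - y k)) ?_ ?_ ?_ isPreconnected_univ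
    · rcases hzero with h | h
      · exact absurd (by simpa using h (w - (x 0 - y 0)) trivial) hw
      · exact sub_eq_zero.mp (h t trivial)
    · refine DifferentiableOn.analyticOnNhd (Differentiable.differentiableOn ?_) isOpen_univ
      fun_prop
    · refine DifferentiableOn.analyticOnNhd (Differentiable.differentiableOn ?_) isOpen_univ
      simp only [Matrix.det_apply, Matrix.of_apply]
      fun_prop
    · intro t _
      by_cases ht : f (t + (x 0 - y 0)) = 0
      · simp only [ht, zero_mul]
      · simp only [generic t ht, sub_self, mul_zero]

lemma det_weighted_ellipticCauchy (hd : Differentiable ℂ f)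
    (hf : ∀ x y, f (x + y) * f (x - y) = φ x * ψ y - ψ x * φ y) {n : ℕ} {u v : Fin n → ℂ}
    {t : ℂ} (c : ℂ) (ht : f t ≠ 0) (hvu : ∀ j k, f (v j - u k) ≠ 0)
    (huu : ∀ j k, j ≠ k → f (u j - u k) ≠ 0) :
    (Matrix.of fun j k : Fin n =>
        c / f t * ((∏ l, f (u k - v l)) / ∏ l ∈ {k}ᶜ, f (u k - u l)) *
          (f (v j - u k + t) / f (v j - u k))).det =
      (-c) ^ n * (f (t + ∑ l, (v l - u l)) / f t) *
        ∏ j, ∏ k ∈ Finset.Ioi j, f (v j - v k) / f (u j - u k) := by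
  have hodd := odd_of_add_mul_sub hf ht
  have key := det_ellipticCauchy hd hf ht hvu t
  have hrow := Matrix.det_mul_row
    (fun k => c / f t * ((∏ l, f (u k - v l)) / ∏ l ∈ {k}ᶜ, f (u k - u l)))
    (Matrix.of fun j k => f (v j - u k + t) / f (v j - u k))
  simp only [Matrix.of_apply] at hrow
  have hsign : ∏ k, ∏ l, f (u k - v l) = (-1) ^ n * ∏ j, ∏ k, f (v j - u k) := by
    have h (k l : Fin n) : f (u k - v l) = -1 * f (v l - u k) := by
      rw [← neg_sub, hodd, neg_one_mul]
    simp only [h, Finset.prod_mul_distrib, Finset.prod_const, Finset.card_univ, Fintype.card_fin]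
    rw [Finset.prod_comm]
    rcases Nat.even_or_odd n with hn | hn <;> simp [hn.neg_one_pow]
  have hoff : ∏ k, ∏ l ∈ {k}ᶜ, f (u k - u l) =
      (∏ j, ∏ k ∈ Finset.Ioi j, f (u k - u j)) * ∏ j, ∏ k ∈ Finset.Ioi j, f (u j - u k) := by
    rw [← Finset.prod_prod_Ioi_mul_eq_prod_prod_off_diag fun l k => f (u k - u l), mul_comm]
    simp only [Finset.prod_mul_distrib]
  have h₁ : ∏ j, ∏ k ∈ Finset.Ioi j, f (u k - u j) ≠ 0 :=
    Finset.prod_ne_zero_iff.mpr fun j _ => Finset.prod_ne_zero_iff.mpr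
      fun k hk => huu k j (Finset.mem_Ioi.mp hk).ne'
  have h₂ : ∏ j, ∏ k ∈ Finset.Ioi j, f (u j - u k) ≠ 0 :=
    Finset.prod_ne_zero_iff.mpr fun j _ => Finset.prod_ne_zero_iff.mpr
      fun k hk => huu j k (Finset.mem_Ioi.mp hk).ne
  have h₃ : ∏ j, ∏ k, f (v j - u k) ≠ 0 :=
    Finset.prod_ne_zero_iff.mpr fun j _ => Finset.prod_ne_zero_iff.mpr fun k _ => hvu j k
  rw [hrow]
  simp only [Finset.prod_mul_distrib, Finset.prod_div_distrib, Finset.prod_const,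
    Finset.card_univ, Fintype.card_fin, hsign, hoff] at key ⊢
  rw [eq_div_iff h₃] at key
  rw [neg_pow c]
  field_simp
  linear_combination c ^ n * key

end ThetaLike

/-- Auxiliary determinant evaluation for the matrix `X_t`, where `[u] = θ₁(ηu;τ)`
and `[0]'` is the derivative of `u ↦ [u]` at `u = 0`. -/
theorem aux_determinant_Xt (n : ℕ) (τ η : ℂ) (hτ : 0 < τ.im) (hη : η ≠ 0)
    (u v : Fin n → ℂ) (γ : ℂ)
    (hu : Function.Injective u) (hv : Function.Injective v)
    (ht : jacobiTheta₁ (η * (∑ l, (u l - v l) + γ)) τ ≠ 0)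
    (hγ : jacobiTheta₁ (η * γ) τ ≠ 0)
    (huv : ∀ k l, jacobiTheta₁ (η * (u k - v l)) τ ≠ 0)
    (huu : ∀ j k, j ≠ k → jacobiTheta₁ (η * (u j - u k)) τ ≠ 0)
    (hvu : ∀ j k, jacobiTheta₁ (η * (v j - u k)) τ ≠ 0) :
    Matrix.det (Matrix.of fun j k : Fin n =>
        deriv (fun w => jacobiTheta₁ (η * w) τ) 0 /
            jacobiTheta₁ (η * (∑ l, (u l - v l) + γ)) τ *
          ((∏ l, jacobiTheta₁ (η * (u k - v l)) τ) /
            ∏ l ∈ Finset.univ.filter (fun l => l ≠ k), jacobiTheta₁ (η * (u k - u l)) τ) *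
          (jacobiTheta₁ (η * (v j - u k + (∑ l, (u l - v l) + γ))) τ /
            jacobiTheta₁ (η * (v j - u k)) τ))
      = (-(deriv (fun w => jacobiTheta₁ (η * w) τ) 0)) ^ n *
          (jacobiTheta₁ (η * γ) τ / jacobiTheta₁ (η * (∑ l, (u l - v l) + γ)) τ) *
          ∏ j, ∏ k ∈ Finset.univ.filter (fun k => j < k),
            jacobiTheta₁ (η * (v j - v k)) τ / jacobiTheta₁ (η * (u j - u k)) τ := by
  let φ : ℂ → ℂ := fun x => jacobiTheta₂ (2 * (η * x)) (2 * τ)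
  let ψ : ℂ → ℂ := fun x =>
    cexp (π * I * τ / 2 + 2 * π * I * (η * x)) * jacobiTheta₂ (2 * (η * x) + τ) (2 * τ)
  have hd : Differentiable ℂ fun x => jacobiTheta₁ (η * x) τ :=
    (differentiable_jacobiTheta₁ hτ).comp (differentiable_id.const_mul η)
  have hf (x y : ℂ) : jacobiTheta₁ (η * (x + y)) τ * jacobiTheta₁ (η * (x - y)) τ =
      φ x * ψ y - ψ x * φ y := by
    rw [mul_add, mul_sub, jacobiTheta₁_add_mul_sub hτ]
  have h := det_weighted_ellipticCauchy (t := ∑ l, (u l - v l) + γ) hd hf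
    (deriv (fun w => jacobiTheta₁ (η * w) τ) 0) ht hvu huu
  have hsum : ∑ l, (u l - v l) + γ + ∑ l, (v l - u l) = γ := by
    simp only [Finset.sum_sub_distrib]
    ring
  have hne (k : Fin n) : Finset.univ.filter (fun l => l ≠ k) = {k}ᶜ := by
    ext l
    simp
  have hlt (j : Fin n) : Finset.univ.filter (fun k => j < k) = Finset.Ioi j := by
    ext k
    simp
  simp only [hne, hlt]
  rw [hsum] at h
  exact h
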